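/- Let q be a positive integer and a an integer. (a) Let (x_i)_{a ≤ i ≤ a+q} be real numbers in (0,1] with q·x_i ∈ ℤ for all i, satisfying x_{i+1} = ⟨2x_i − x_{i−1}⟩ for all i with a+1 ≤ i ≤ a+q−1, and set d = ⟨x_{a+1} − x_a⟩. Then Σ_{i=a+1}^{a+q} F(x_i, x_{i−1}) = (1/12)·[ 6·( q·d² + (1 − 2d)·[x_a + dq]₁ ) − q ]. (b) Let γ be an integer with 1 ≤ γ ≤ q−1 and let (x_i)_{a ≤ i ≤ a+γ} be real numbers in (0,1] satisfying x_{i+1} = ⟨2x_i − x_{i−1}⟩ for all i with a+1 ≤ i ≤ a+γ−1, and set d = ⟨x_{a+1} − x_a⟩. Then Σ_{i=a+1}^{a+γ} F(x_i, x_{i−1}) = (1/12)·[ 6·( γ·d² + (1 − 2d)·[x_a + dγ]₁ + B₂(x_{a+γ}) − B₂(x_a) ) − γ ]. -/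

import Mathlib

/-- `⟨x⟩`: the unique element of `(0,1]` congruent to `x` modulo `ℤ`
(`⟨x⟩ = x - ⌊x⌋` for `x ∉ ℤ`, and `⟨x⟩ = 1` for `x ∈ ℤ`). -/
noncomputable def ufrac (x : ℝ) : ℝ := x - ⌈x⌉ + 1

/-- `[x]₁ := x - ⟨x⟩`. -/
noncomputable def ipart (x : ℝ) : ℝ := x - ufrac x

/-- The first Bernoulli polynomial `B₁(x) = x - 1/2`. -/
noncomputable def B1 (x : ℝ) : ℝ := x - 1/2

/-- The second Bernoulli polynomial `B₂(x) = x² - x + 1/6`. -/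
noncomputable def B2 (x : ℝ) : ℝ := x^2 - x + 1/6

/-- `F(x, y) := -B₁(x)B₁(y) + B₂(x)`. -/
noncomputable def Fcal (x y : ℝ) : ℝ := -(B1 x * B1 y) + B2 x

theorem ufrac_mem_Ioc (x : ℝ) : ufrac x ∈ Set.Ioc (0:ℝ) 1 := by
  have h1 := Int.le_ceil x
  have h2 := Int.ceil_lt_add_one x
  constructor <;> unfold ufrac <;> linarith

theorem ufrac_eq_sub_of_mem {x : ℝ} {k : ℤ} (h : x - k ∈ Set.Ioc (0:ℝ) 1) :
    ufrac x = x - k := by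
  have hc : ⌈x⌉ = k + 1 := by
    rw [Int.ceil_eq_iff]
    push_cast
    constructor <;> linarith [h.1, h.2]
  rw [ufrac, hc]
  push_cast
  ring

theorem exists_ufrac_eq_sub (x : ℝ) : ∃ k : ℤ, ufrac x = x - k :=
  ⟨⌈x⌉ - 1, by rw [ufrac]; push_cast; ring⟩

theorem ufrac_sub_intCast (x : ℝ) (k : ℤ) : ufrac (x - k) = ufrac x := by
  simp only [ufrac, Int.ceil_sub_intCast]
  push_cast
  ring

theorem Fcal_eq (x y : ℝ) :
    Fcal x y = (B2 x - B2 y) / 2 + (x - y) ^ 2 / 2 - 1 / 12 := by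
  simp only [Fcal, B1, B2]
  ring

/-- Adding `d ∈ (0,1]` to a point of `(0,1]` and reducing subtracts either `0` or `1`. -/
theorem ufrac_add_cases {x d : ℝ} (hx : x ∈ Set.Ioc (0:ℝ) 1) (hd : d ∈ Set.Ioc (0:ℝ) 1) :
    ufrac (x + d) = x + d ∨ ufrac (x + d) = x + d - 1 := by
  rcases le_or_gt (x + d) 1 with h | h
  · left
    simpa using ufrac_eq_sub_of_mem (x := x + d) (k := 0)
      ⟨by push_cast; linarith [hx.1, hd.1], by push_cast; linarith⟩
  · right
    simpa using ufrac_eq_sub_of_mem (x := x + d) (k := 1)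
      ⟨by push_cast; linarith, by push_cast; linarith [hx.2, hd.2]⟩

/-- The sum of `F` along an orbit of the rotation by `d`. -/
theorem sum_Fcal_rotation {d : ℝ} (hd : d ∈ Set.Ioc (0:ℝ) 1) (a : ℤ) (x : ℤ → ℝ)
    (ha : x a ∈ Set.Ioc (0:ℝ) 1) (n : ℕ)
    (hx : ∀ m : ℕ, m < n → x (a + m + 1) = ufrac (x (a + m) + d)) :
    x (a + n) = ufrac (x a + d * n) ∧
    ∑ i ∈ Finset.Icc (a + 1) (a + (n:ℤ)), Fcal (x i) (x (i - 1)) =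
      (1/12) * (6 * (n * d ^ 2 + (1 - 2 * d) * ipart (x a + d * n)
        + B2 (x (a + n)) - B2 (x a)) - n) := by
  suffices H : ∃ k : ℤ, x (a + n) = x a + d * n - k ∧ x (a + n) ∈ Set.Ioc (0:ℝ) 1 ∧
      ∑ i ∈ Finset.Icc (a + 1) (a + (n:ℤ)), Fcal (x i) (x (i - 1)) =
        (1/12) * (6 * (n * d ^ 2 + (1 - 2 * d) * k + B2 (x (a + n)) - B2 (x a)) - n) by
    obtain ⟨k, hk, hmem, hsum⟩ := H
    have hu : ufrac (x a + d * n) = x a + d * n - k := ufrac_eq_sub_of_mem (hk ▸ hmem)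
    refine ⟨hk.trans hu.symm, ?_⟩
    rw [hsum, ipart, hu, sub_sub_cancel]
  induction n with
  | zero => exact ⟨0, by simp, by simpa using ha, by simp⟩
  | succ n ih =>
    obtain ⟨k, hk, hmem, hsum⟩ := ih fun m hm => hx m (by omega)
    have hstep := hx n (by omega)
    have hIcc : Finset.Icc (a + 1) (a + (n:ℤ) + 1) =
        insert (a + (n:ℤ) + 1) (Finset.Icc (a + 1) (a + (n:ℤ))) := by
      ext i
      simp only [Finset.mem_insert, Finset.mem_Icc]
      omega
    have hmem' : x (a + n + 1) ∈ Set.Ioc (0:ℝ) 1 := hstep ▸ ufrac_mem_Ioc _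
    have hcast : a + ((n + 1 : ℕ) : ℤ) = a + n + 1 := by push_cast; ring
    rw [hcast, hIcc, Finset.sum_insert (by simp), hsum, Fcal_eq, add_sub_cancel_right]
    rcases ufrac_add_cases hmem hd with h | h <;> rw [h] at hstep
    · refine ⟨k, by rw [hstep, hk]; push_cast; ring, hmem', ?_⟩
      have hdiff : x (a + n + 1) - x (a + n) = d := by linarith
      rw [hdiff]
      push_cast
      ring
    · refine ⟨k + 1, by rw [hstep, hk]; push_cast; ring, hmem', ?_⟩
      have hdiff : x (a + n + 1) - x (a + n) = d - 1 := by linarith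
      rw [hdiff]
      push_cast
      ring

/-- A sequence with vanishing second difference modulo `ℤ` is an orbit of a rotation. -/
theorem rotation_of_second_difference (a : ℤ) (x : ℤ → ℝ) (n : ℕ)
    (h1 : x (a + 1) ∈ Set.Ioc (0:ℝ) 1)
    (hx : ∀ i, a + 1 ≤ i → i ≤ a + n - 1 → x (i + 1) = ufrac (2 * x i - x (i - 1)))
    (m : ℕ) (hm : m < n) :
    x (a + m + 1) = ufrac (x (a + m) + ufrac (x (a + 1) - x a)) := by
  induction m with
  | zero =>
    obtain ⟨k, hk⟩ := exists_ufrac_eq_sub (x (a + 1) - x a)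
    have h : x a + (x (a + 1) - x a - k) = x (a + 1) - k := by ring
    have h' : ufrac (x (a + 1)) = x (a + 1) := by
      simpa using ufrac_eq_sub_of_mem (x := x (a + 1)) (k := 0) (by simpa using h1)
    simp [hk, h, ufrac_sub_intCast, h']
  | succ m ih =>
    have hm' := ih (by omega)
    obtain ⟨k, hk⟩ := exists_ufrac_eq_sub (x (a + m) + ufrac (x (a + 1) - x a))
    have hcast : a + ((m + 1 : ℕ) : ℤ) = a + m + 1 := by push_cast; ring
    rw [hcast, hx (a + m + 1) (by omega) (by omega), add_sub_cancel_right,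
      ← ufrac_sub_intCast (x (a + m + 1) + _) k]
    congr 1
    linarith

/-- (a) For a full period of length `q` (with `q·x_i ∈ ℤ`),
`Σ_{i=a+1}^{a+q} F(x_i, x_{i-1}) = (1/12)[6(qd² + (1-2d)[x_a + dq]₁) - q]`;
(b) for a partial run of length `1 ≤ γ ≤ q-1`,
`Σ_{i=a+1}^{a+γ} F(x_i, x_{i-1}) = (1/12)[6(γd² + (1-2d)[x_a + dγ]₁ + B₂(x_{a+γ}) - B₂(x_a)) - γ]`,
where `d = ⟨x_{a+1} - x_a⟩`. -/
theorem stmt_16 (q : ℕ) (hq : 0 < q) (a : ℤ) :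
    (∀ x : ℤ → ℝ,
      (∀ i, a ≤ i → i ≤ a + q → x i ∈ Set.Ioc (0:ℝ) 1 ∧ ∃ z : ℤ, (q:ℝ) * x i = z) →
      (∀ i, a + 1 ≤ i → i ≤ a + q - 1 → x (i+1) = ufrac (2 * x i - x (i-1))) →
      ∑ i ∈ Finset.Icc (a+1) (a+(q:ℤ)), Fcal (x i) (x (i-1))
        = (1/12) * (6 * ((q:ℝ) * (ufrac (x (a+1) - x a))^2
            + (1 - 2 * ufrac (x (a+1) - x a)) * ipart (x a + ufrac (x (a+1) - x a) * q)) - q))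
    ∧
    (∀ γ : ℤ, 1 ≤ γ → γ ≤ (q:ℤ) - 1 → ∀ x : ℤ → ℝ,
      (∀ i, a ≤ i → i ≤ a + γ → x i ∈ Set.Ioc (0:ℝ) 1) →
      (∀ i, a + 1 ≤ i → i ≤ a + γ - 1 → x (i+1) = ufrac (2 * x i - x (i-1))) →
      ∑ i ∈ Finset.Icc (a+1) (a+γ), Fcal (x i) (x (i-1))
        = (1/12) * (6 * ((γ:ℝ) * (ufrac (x (a+1) - x a))^2
            + (1 - 2 * ufrac (x (a+1) - x a)) * ipart (x a + ufrac (x (a+1) - x a) * γ)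
            + B2 (x (a+γ)) - B2 (x a)) - γ)) := by
  constructor
  · intro x hmem hx
    have ha := hmem a le_rfl (by omega)
    have h1 := hmem (a + 1) (by omega) (by omega)
    obtain ⟨hend, hsum⟩ := sum_Fcal_rotation (ufrac_mem_Ioc (x (a + 1) - x a)) a x ha.1 q
      (rotation_of_second_difference a x q h1.1 hx)
    obtain ⟨z₀, hz₀⟩ := ha.2
    obtain ⟨z₁, hz₁⟩ := h1.2
    obtain ⟨k, hk⟩ := exists_ufrac_eq_sub (x (a + 1) - x a)
    have hperiod : x (a + q) = x a := by
      have hshift : x a + ufrac (x (a + 1) - x a) * q - ((z₁ - z₀ - k * q : ℤ) : ℝ) = x a := by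
        rw [hk]
        push_cast
        linarith
      rw [hend, ufrac_eq_sub_of_mem (k := z₁ - z₀ - k * q) (hshift.symm ▸ ha.1), hshift]
    rw [hsum, hperiod, add_sub_cancel_right]
  · intro γ hγ _ x hmem hx
    lift γ to ℕ using by omega
    simpa using (sum_Fcal_rotation (ufrac_mem_Ioc (x (a + 1) - x a)) a x
      (hmem a le_rfl (by omega)) γ
      (rotation_of_second_difference a x γ (hmem (a + 1) (by omega) (by omega)) hx)).2
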